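/- Joint continuity of the transport cost: Under the compact setup, the map (μ, θ, ν) ↦ W_c((T_θ)_#μ, ν) is jointly continuous on P(X) × Θ × P(Z), where P(X) and P(Z) carry the topology of weak convergence of probability measures; i.e., if μ_k → μ_∞ weakly in P(X), θ_k → θ_∞ in Θ, and ν_k → ν_∞ weakly in P(Z), then W_c((T_{θ_k})_#μ_k, ν_k) → W_c((T_{θ_∞})_#μ_∞, ν_∞). -/

import Mathlib

open MeasureTheory

/-- The optimal transport cost between two measures on `Z` for cost `c`. -/
noncomputable def transportCost {Z : Type*} [MeasurableSpace Z]
    (c : Z × Z → ℝ) (α β : Measure Z) : ℝ :=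
  sInf { v : ℝ | ∃ π : Measure (Z × Z),
    π.map Prod.fst = α ∧ π.map Prod.snd = β ∧ v = ∫ p, c p ∂π }


section helpers

variable {Z : Type*} [MetricSpace Z] [CompactSpace Z] [MeasurableSpace Z] [BorelSpace Z]

lemma otc_integrable {Y : Type*} [TopologicalSpace Y] [CompactSpace Y] [MeasurableSpace Y]
    [OpensMeasurableSpace Y] (μ : Measure Y) [IsFiniteMeasure μ] {f : Y → ℝ}
    (hf : Continuous f) : Integrable f μ :=
  hf.integrable_of_hasCompactSupport (HasCompactSupport.of_compactSpace f)

lemma otc_density (α β : Measure Z) [IsProbabilityMeasure α] [IsProbabilityMeasure β]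
    (G : Z × Z → ℝ) (hG : Continuous G) (h0 : ∀ p, 0 ≤ G p)
    (h1 : ∀ x, ∫ y, G (x, y) ∂β = 1) (h2 : ∀ y, ∫ x, G (x, y) ∂α = 1) (c : Z × Z → ℝ) :
    ∃ π : Measure (Z × Z), π.map Prod.fst = α ∧ π.map Prod.snd = β ∧
      ∫ p, c p ∂π = ∫ p, G p * c p ∂(α.prod β) := by
  have hm : Measurable fun p => ENNReal.ofReal (G p) := hG.measurable.ennreal_ofReal
  refine ⟨(α.prod β).withDensity fun p => ENNReal.ofReal (G p), ?_, ?_, ?_⟩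
  · ext s hs
    rw [Measure.map_apply measurable_fst hs, withDensity_apply _ (measurable_fst hs),
      ← Set.prod_univ, ← Measure.prod_restrict, lintegral_prod _ hm.aemeasurable]
    have : ∀ x, ∫⁻ y, ENNReal.ofReal (G (x, y)) ∂(β.restrict Set.univ) = 1 := by
      intro x
      rw [Measure.restrict_univ, ← ofReal_integral_eq_lintegral_ofReal
        (otc_integrable β (by fun_prop)) (Filter.Eventually.of_forall fun y => h0 _), h1]
      simp
    simp_rw [this]
    simp
  · ext s hs
    rw [Measure.map_apply measurable_snd hs, withDensity_apply _ (measurable_snd hs),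
      ← Set.univ_prod, ← Measure.prod_restrict, lintegral_prod_symm _ hm.aemeasurable]
    have : ∀ y, ∫⁻ x, ENNReal.ofReal (G (x, y)) ∂(α.restrict Set.univ) = 1 := by
      intro x
      rw [Measure.restrict_univ, ← ofReal_integral_eq_lintegral_ofReal
        (otc_integrable α (by fun_prop)) (Filter.Eventually.of_forall fun y => h0 _), h2]
      simp
    simp_rw [this]
    simp
  · rw [integral_withDensity_eq_integral_toReal_smul hm (by simp)]
    simp [h0]

lemma otc_partition (δ : ℝ) (hδ : 0 < δ) :
    ∃ (t : Finset Z) (f : t → Z → ℝ), (∀ i, Continuous (f i)) ∧ (∀ i x, 0 ≤ f i x) ∧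
      (∀ x, ∑ i, f i x = 1) ∧ ∀ i x, f i x ≠ 0 → dist x i < δ := by
  obtain ⟨t, -, ht, hcov⟩ := finite_cover_balls_of_compact (isCompact_univ (X := Z)) hδ
  lift t to Finset Z using ht
  let h : t → Z → ℝ := fun i x => max 0 (δ - dist x i)
  have hh : ∀ i, Continuous (h i) := fun i => by fun_prop
  have h0 : ∀ i x, 0 ≤ h i x := fun i x => le_max_left _ _
  have hpos : ∀ x, 0 < ∑ i, h i x := by
    intro x
    have := hcov (Set.mem_univ x)
    simp only [Set.mem_iUnion, Metric.mem_ball] at this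
    obtain ⟨i, hi, hx⟩ := this
    refine Finset.sum_pos' (fun i _ => h0 i x) ⟨⟨i, hi⟩, Finset.mem_univ _, ?_⟩
    exact lt_max_of_lt_right (by simpa using hx)
  refine ⟨t, fun i x => h i x / ∑ j, h j x, ?_, ?_, ?_, ?_⟩
  · intro i
    exact (hh i).div (by fun_prop) fun x => (hpos x).ne'
  · intro i x
    exact div_nonneg (h0 i x) (hpos x).le
  · intro x
    rw [← Finset.sum_div, div_self (hpos x).ne']
  · intro i x hx
    by_contra hcon
    apply hx
    have : h i x = 0 := max_eq_left (by linarith)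
    simp_rw [this]
    simp

lemma otc_prod_integral (α β : Measure Z) [IsProbabilityMeasure α] [IsProbabilityMeasure β]
    {ι : Type*} [Fintype ι] (f : ι → Z → ℝ) (hf : ∀ i, Continuous (f i))
    (P : ι → ι → ℝ) (x : Z) : ∫ y, ∑ i, ∑ j, P i j * (f i x * f j y) ∂β =
      ∑ i, (∑ j, P i j * ∫ y, f j y ∂β) * f i x := by
  rw [integral_finsetSum]
  · congr 1; ext i
    rw [integral_finsetSum]
    · rw [Finset.sum_mul]; congr 1; ext j
      rw [integral_const_mul, integral_const_mul]; ring
    · intro j _; exact otc_integrable β (by fun_prop)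
  · intro j _; exact otc_integrable β (by fun_prop)

/-- The main construction. -/
lemma otc_main (c : Z × Z → ℝ) (hc : Continuous c) (C ε : ℝ) (hC : ∀ p, |c p| ≤ C)
    {ι : Type*} [Fintype ι] (f : ι → Z → ℝ) (z : ι → Z) (hf : ∀ i, Continuous (f i))
    (f0 : ∀ i x, 0 ≤ f i x) (f1 : ∀ x, ∑ i, f i x = 1)
    (hfc : ∀ i j x y, f i x ≠ 0 → f j y ≠ 0 → |c (x, y) - c (z i, z j)| ≤ ε)
    (π : Measure (Z × Z)) [IsProbabilityMeasure π]
    (α β : Measure Z) [IsProbabilityMeasure α] [IsProbabilityMeasure β]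
    (l : ℝ) (hl0 : 0 < l) (hl1 : l < 1)
    (ha : ∀ i, l * ∫ p, f i p.1 ∂π ≤ ∫ x, f i x ∂α)
    (hb : ∀ i, l * ∫ p, f i p.2 ∂π ≤ ∫ x, f i x ∂β) :
    ∃ π' : Measure (Z × Z), π'.map Prod.fst = α ∧ π'.map Prod.snd = β ∧
      ∫ p, c p ∂π' ≤ ∫ p, c p ∂π + 2 * ε + 2 * (1 - l) * C := by
  set P : ι → ι → ℝ := fun i j => ∫ p, f i p.1 * f j p.2 ∂π with hP
  set A : ι → ℝ := fun i => ∫ x, f i x ∂α with hA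
  set B : ι → ℝ := fun i => ∫ x, f i x ∂β with hB
  have A0 : ∀ i, 0 ≤ A i := fun i => integral_nonneg (f0 i)
  have B0 : ∀ i, 0 ≤ B i := fun i => integral_nonneg (f0 i)
  have P0 : ∀ i j, 0 ≤ P i j := fun i j => integral_nonneg fun p => mul_nonneg (f0 i _) (f0 j _)
  have Pa : ∀ i, ∑ j, P i j = ∫ p, f i p.1 ∂π := by
    intro i
    rw [hP, ← integral_finsetSum]
    · simp [← Finset.mul_sum, f1]
    · intro j _; exact otc_integrable π (by fun_prop)
  have Pb : ∀ j, ∑ i, P i j = ∫ p, f j p.2 ∂π := by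
    intro i
    rw [hP, ← integral_finsetSum]
    · simp [← Finset.sum_mul, f1]
    · intro j _; exact otc_integrable π (by fun_prop)
  have sumA : ∑ i, A i = 1 := by
    rw [hA, ← integral_finsetSum]
    · simp [f1]
    · intro j _; exact otc_integrable α (by fun_prop)
  have sumB : ∑ i, B i = 1 := by
    rw [hB, ← integral_finsetSum]
    · simp [f1]
    · intro j _; exact otc_integrable β (by fun_prop)
  have sumP : ∑ i, ∑ j, P i j = 1 := by
    simp_rw [Pa]
    rw [← integral_finsetSum]
    · simp [f1]
    · intro j _; exact otc_integrable π (by fun_prop)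
  have PA : ∀ i j, A i = 0 → P i j = 0 := by
    intro i j h
    have h1 := ha i
    rw [← Pa] at h1
    have h2 : P i j ≤ ∑ j, P i j := Finset.single_le_sum (fun j _ => P0 i j) (Finset.mem_univ j)
    have h3 : l * P i j ≤ 0 := (mul_le_mul_of_nonneg_left h2 hl0.le).trans (h1.trans h.le)
    nlinarith [P0 i j]
  have PB : ∀ i j, B j = 0 → P i j = 0 := by
    intro i j h
    have h1 := hb j
    rw [← Pb] at h1
    have h2 : P i j ≤ ∑ i, P i j :=
      Finset.single_le_sum (f := fun i => P i j) (fun i _ => P0 i j) (Finset.mem_univ i)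
    have h3 : l * P i j ≤ 0 := (mul_le_mul_of_nonneg_left h2 hl0.le).trans (h1.trans h.le)
    nlinarith [P0 i j]
  -- the weights
  set Q : ι → ι → ℝ := fun i j => l * P i j / (A i * B j) with hQ
  have Q0 : ∀ i j, 0 ≤ Q i j := fun i j =>
    div_nonneg (mul_nonneg hl0.le (P0 i j)) (mul_nonneg (A0 i) (B0 j))
  have QB : ∀ i j, Q i j * B j = l * P i j / A i := by
    intro i j
    by_cases h : B j = 0
    · simp [h, PB i j h]
    · simp only [hQ]; rw [mul_comm (A i), ← div_div]; field_simp
  have QA : ∀ i j, Q i j * A i = l * P i j / B j := by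
    intro i j
    by_cases h : A i = 0
    · simp [h, PA i j h]
    · simp only [hQ]; rw [← div_div]; field_simp
  have QAB : ∀ i j, Q i j * (A i * B j) = l * P i j := by
    intro i j
    rw [← mul_assoc, QA]
    by_cases h : B j = 0
    · simp [h, PB i j h]
    · field_simp
  set a : ι → ℝ := fun i => ∑ j, l * P i j / A i with ha'
  set b : ι → ℝ := fun j => ∑ i, l * P i j / B j with hb'
  have a1 : ∀ i, a i ≤ 1 := by
    intro i
    simp only [ha']
    rw [← Finset.sum_div, ← Finset.mul_sum, Pa]
    exact div_le_one_of_le₀ (ha i) (A0 i)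
  have b1 : ∀ i, b i ≤ 1 := by
    intro i
    simp only [hb']
    rw [← Finset.sum_div, ← Finset.mul_sum, Pb]
    exact div_le_one_of_le₀ (hb i) (B0 i)
  have aA : ∑ i, a i * A i = l := by
    have : ∀ i, a i * A i = l * ∑ j, P i j := by
      intro i
      simp only [ha']
      rw [Finset.mul_sum, Finset.sum_mul]
      refine Finset.sum_congr rfl fun j _ => ?_
      by_cases h : A i = 0
      · simp [h, PA i j h]
      · field_simp
    simp_rw [this]
    rw [← Finset.mul_sum, sumP, mul_one]
  have bB : ∑ i, b i * B i = l := by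
    have : ∀ j, b j * B j = l * ∑ i, P i j := by
      intro j
      simp only [hb']
      rw [Finset.mul_sum, Finset.sum_mul]
      refine Finset.sum_congr rfl fun i _ => ?_
      by_cases h : B j = 0
      · simp [h, PB i j h]
      · field_simp
    simp_rw [this]
    rw [← Finset.mul_sum, Finset.sum_comm, sumP, mul_one]
  set u : Z → ℝ := fun x => 1 - ∑ i, a i * f i x with hu
  set v : Z → ℝ := fun x => 1 - ∑ i, b i * f i x with hv
  have uc : Continuous u := by fun_prop
  have vc : Continuous v := by fun_prop
  have u0 : ∀ x, 0 ≤ u x := by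
    intro x
    have : ∑ i, a i * f i x ≤ ∑ i, f i x :=
      Finset.sum_le_sum fun i _ => mul_le_of_le_one_left (f0 i x) (a1 i)
    rw [f1] at this
    simp only [hu]; linarith
  have v0 : ∀ x, 0 ≤ v x := by
    intro x
    have : ∑ i, b i * f i x ≤ ∑ i, f i x :=
      Finset.sum_le_sum fun i _ => mul_le_of_le_one_left (f0 i x) (b1 i)
    rw [f1] at this
    simp only [hv]; linarith
  have iu : ∫ x, u x ∂α = 1 - l := by
    simp only [hu]
    rw [integral_sub (integrable_const _) (otc_integrable α (by fun_prop)), integral_finsetSum]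
    · simp_rw [integral_const_mul]; simp [← aA, hA]
    · intro j _; exact otc_integrable α (by fun_prop)
  have iv : ∫ x, v x ∂β = 1 - l := by
    simp only [hv]
    rw [integral_sub (integrable_const _) (otc_integrable β (by fun_prop)), integral_finsetSum]
    · simp_rw [integral_const_mul]; simp [← bB, hB]
    · intro j _; exact otc_integrable β (by fun_prop)
  have hl : 0 < 1 - l := by linarith
  set G : Z × Z → ℝ := fun p => ∑ i, ∑ j, Q i j * (f i p.1 * f j p.2) +
    u p.1 * v p.2 / (1 - l) with hG
  obtain ⟨π', h1, h2, h3⟩ := otc_density α β G (by fun_prop)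
    (by
      intro p
      refine add_nonneg (Finset.sum_nonneg fun i _ => Finset.sum_nonneg fun j _ => ?_) ?_
      · exact mul_nonneg (Q0 i j) (mul_nonneg (f0 _ _) (f0 _ _))
      · exact div_nonneg (mul_nonneg (u0 _) (v0 _)) hl.le)
    (by
      intro x
      simp only [hG]
      rw [integral_add (otc_integrable β (by fun_prop)) (otc_integrable β (by fun_prop)),
        otc_prod_integral α β f hf, integral_div, integral_const_mul, iv,
        mul_div_cancel_right₀ _ hl.ne']
      have : ∀ i, ∑ j, Q i j * ∫ y, f j y ∂β = a i :=
        fun i => Finset.sum_congr rfl fun j _ => QB i j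
      simp_rw [this]
      simp [hu])
    (by
      intro y
      simp only [hG]
      rw [integral_add (otc_integrable α (by fun_prop)) (otc_integrable α (by fun_prop)),
        integral_div, integral_mul_const, iu, mul_div_cancel_left₀ _ hl.ne']
      have e : ∀ x, ∑ i, ∑ j, Q i j * (f i x * f j y) =
          ∑ j, ∑ i, Q i j * (f j y * f i x) := by
        intro x; rw [Finset.sum_comm]; simp_rw [mul_comm (f _ x)]
      simp_rw [e]
      rw [otc_prod_integral β α f hf (fun i j => Q j i)]
      have : ∀ i, ∑ j, Q j i * ∫ y, f j y ∂α = b i :=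
        fun i => Finset.sum_congr rfl fun j _ => QA j i
      simp_rw [this]
      simp [hv]) c
  refine ⟨π', h1, h2, ?_⟩
  rw [h3]
  have C0 : 0 ≤ C := by
    obtain ⟨p⟩ := nonempty_of_isProbabilityMeasure π
    exact (abs_nonneg _).trans (hC p)
  set S := ∑ i, ∑ j, P i j * c (z i, z j) with hS
  -- upper bound
  have key1 : ∫ p, G p * c p ∂(α.prod β) ≤ l * (S + ε) + (1 - l) * C := by
    have hle : ∀ p, G p * c p ≤ ∑ i, ∑ j, Q i j * (c (z i, z j) + ε) * (f i p.1 * f j p.2) +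
        C / (1 - l) * (u p.1 * v p.2) := by
      intro p
      simp only [hG, add_mul, Finset.sum_mul]
      refine add_le_add (Finset.sum_le_sum fun i _ => Finset.sum_le_sum fun j _ => ?_) ?_
      · have hq : f i p.1 * f j p.2 * c p ≤ f i p.1 * f j p.2 * (c (z i, z j) + ε) := by
          by_cases hi : f i p.1 = 0
          · simp [hi]
          by_cases hj : f j p.2 = 0
          · simp [hj]
          refine mul_le_mul_of_nonneg_left ?_ (mul_nonneg (f0 _ _) (f0 _ _))
          have := (abs_le.1 (hfc i j p.1 p.2 hi hj)).2
          simp only [Prod.mk.eta] at this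
          linarith
        have := mul_le_mul_of_nonneg_left hq (Q0 i j)
        linarith
      · have := mul_le_mul_of_nonneg_left (abs_le.1 (hC p)).2
          (div_nonneg (mul_nonneg (u0 p.1) (v0 p.2)) hl.le)
        calc _ ≤ _ := this
          _ = _ := by ring
    have hGc : Continuous fun p => G p * c p := by fun_prop
    refine (integral_mono (otc_integrable _ hGc) (otc_integrable _ (by fun_prop)) hle).trans ?_
    rw [integral_add (otc_integrable _ (by fun_prop)) (otc_integrable _ (by fun_prop)),
      integral_const_mul, integral_prod_mul u v, iu, iv, integral_finsetSum]
    · have : ∀ i, ∫ p : Z × Z, ∑ j, Q i j * (c (z i, z j) + ε) * (f i p.1 * f j p.2) ∂(α.prod β)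
          = ∑ j, l * (P i j * c (z i, z j) + P i j * ε) := by
        intro i
        rw [integral_finsetSum]
        · refine Finset.sum_congr rfl fun j _ => ?_
          rw [integral_const_mul, integral_prod_mul (f i) (f j)]
          calc _ = (Q i j * (A i * B j)) * (c (z i, z j) + ε) := by ring
            _ = _ := by rw [QAB]; ring
        · intro j _; exact otc_integrable _ (by fun_prop)
      simp_rw [this, ← Finset.mul_sum, Finset.sum_add_distrib, ← Finset.sum_mul, sumP]
      rw [← hS, one_mul]
      have : C / (1 - l) * ((1 - l) * (1 - l)) = (1 - l) * C := by field_simp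
      rw [this]
    · intro j _; exact otc_integrable _ (by fun_prop)
  have Sexp : ∀ k : ℝ, ∫ p, ∑ i, ∑ j, (c (z i, z j) + k) * (f i p.1 * f j p.2) ∂π = S + k := by
    intro k
    rw [integral_finsetSum]
    · have : ∀ i, ∫ p : Z × Z, ∑ j, (c (z i, z j) + k) * (f i p.1 * f j p.2) ∂π
          = ∑ j, (P i j * c (z i, z j) + P i j * k) := by
        intro i
        rw [integral_finsetSum]
        · refine Finset.sum_congr rfl fun j _ => ?_
          rw [integral_const_mul]
          simp only [hP]; ring
        · intro j _; exact otc_integrable _ (by fun_prop)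
      simp_rw [this, Finset.sum_add_distrib, ← Finset.sum_mul, sumP]
      rw [← hS, one_mul]
    · intro j _; exact otc_integrable _ (by fun_prop)
  have key2 : S - ε ≤ ∫ p, c p ∂π := by
    have := Sexp (-ε)
    rw [sub_eq_add_neg, ← this]
    refine integral_mono (otc_integrable _ (by fun_prop)) (otc_integrable _ hc) fun p => ?_
    have e : c p = ∑ i, ∑ j, c p * (f i p.1 * f j p.2) := by
      simp_rw [← Finset.mul_sum, f1, mul_one, f1, mul_one]
    simp only
    rw [e]
    refine Finset.sum_le_sum fun i _ => Finset.sum_le_sum fun j _ => ?_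
    by_cases hi : f i p.1 = 0
    · simp [hi]
    by_cases hj : f j p.2 = 0
    · simp [hj]
    refine mul_le_mul_of_nonneg_right ?_ (mul_nonneg (f0 _ _) (f0 _ _))
    have := (abs_le.1 (hfc i j p.1 p.2 hi hj)).1
    simp only [Prod.mk.eta] at this
    linarith
  have key3 : -C ≤ S := by
    rw [hS]
    have : ∑ i, ∑ j, P i j * (-C) ≤ ∑ i, ∑ j, P i j * c (z i, z j) :=
      Finset.sum_le_sum fun i _ => Finset.sum_le_sum fun j _ =>
        mul_le_mul_of_nonneg_left (abs_le.1 (hC _)).1 (P0 i j)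
    simp_rw [← Finset.sum_mul, sumP] at this
    linarith
  have ε0 : 0 ≤ ε := by
    obtain ⟨p⟩ := nonempty_of_isProbabilityMeasure π
    have hex : ∀ x, ∃ i, f i x ≠ 0 := by
      intro x
      by_contra! h
      have := f1 x
      simp [h] at this
    obtain ⟨i, hi⟩ := hex p.1
    exact (abs_nonneg _).trans (hfc i i _ _ hi hi)
  nlinarith

/-- couplings attached to probability measures -/
lemma otc_bound (c : Z × Z → ℝ) (hc : Continuous c) :
    ∃ C, 0 ≤ C ∧ ∀ p, |c p| ≤ C := by
  obtain ⟨C, h⟩ := (isCompact_univ (X := Z × Z)).exists_bound_of_continuousOn hc.continuousOn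
  exact ⟨max C 0, le_max_right _ _, fun p => (h p (Set.mem_univ p)).trans (le_max_left _ _)⟩

lemma otc_prob {α : Measure Z} [IsProbabilityMeasure α] {π : Measure (Z × Z)}
    (h : π.map Prod.fst = α) : IsProbabilityMeasure π := by
  constructor
  have : π.map Prod.fst Set.univ = 1 := by rw [h]; simp
  rwa [Measure.map_apply measurable_fst MeasurableSet.univ, Set.preimage_univ] at this

lemma otc_bddBelow (c : Z × Z → ℝ) (hc : Continuous c) (α β : Measure Z)
    [IsProbabilityMeasure α] :
    BddBelow { v : ℝ | ∃ π : Measure (Z × Z),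
    π.map Prod.fst = α ∧ π.map Prod.snd = β ∧ v = ∫ p, c p ∂π } := by
  obtain ⟨C, -, hC⟩ := otc_bound c hc
  refine ⟨-C, ?_⟩
  rintro v ⟨π, h1, -, rfl⟩
  have := otc_prob h1
  have := norm_integral_le_of_norm_le_const (μ := π) (f := c) (Filter.Eventually.of_forall hC)
  simp at this
  exact (abs_le.1 this).1

lemma otc_nonempty (c : Z × Z → ℝ) (α β : Measure Z)
    [IsProbabilityMeasure α] [IsProbabilityMeasure β] :
    { v : ℝ | ∃ π : Measure (Z × Z),
    π.map Prod.fst = α ∧ π.map Prod.snd = β ∧ v = ∫ p, c p ∂π }.Nonempty :=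
  ⟨_, α.prod β, by simp, by simp, rfl⟩

lemma otc_usc (c : Z × Z → ℝ) (hc : Continuous c) :
    UpperSemicontinuous (fun p : ProbabilityMeasure Z × ProbabilityMeasure Z =>
      transportCost c (p.1 : Measure Z) (p.2 : Measure Z)) := by
  rintro ⟨α, β⟩ r hr
  obtain ⟨_, ⟨π, h1, h2, rfl⟩, hlt⟩ := exists_lt_of_csInf_lt (otc_nonempty c _ _) hr
  have := otc_prob h1
  obtain ⟨C, C0, hC⟩ := otc_bound c hc
  set e := (r - ∫ p, c p ∂π) / 8 with he
  have e0 : 0 < e := by simp only [he]; linarith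
  obtain ⟨δ, δ0, hδ⟩ := Metric.uniformContinuous_iff.1
    (CompactSpace.uniformContinuous_of_continuous hc) e e0
  obtain ⟨t, f, fc, f0, f1, fd⟩ := otc_partition (Z := Z) δ δ0
  set η := min (1 / 2) (e / (C + 1)) with hη
  have η0 : 0 < η := lt_min (by norm_num) (by positivity)
  have η1 : η ≤ 1 / 2 := min_le_left _ _
  have ηC : η * C ≤ e := by
    have : η * (C + 1) ≤ e := by
      rw [← le_div_iff₀ (by positivity)]; exact min_le_right _ _
    linarith
  have ea : ∀ i, ∀ᶠ p : ProbabilityMeasure Z × ProbabilityMeasure Z in nhds (α, β),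
      (1 - η) * ∫ p, f i p.1 ∂π ≤ ∫ x, f i x ∂(p.1 : Measure Z) := by
    intro i
    have e1 : ∫ p, f i p.1 ∂π = ∫ x, f i x ∂(α : Measure Z) := by
      rw [← h1, integral_map measurable_fst.aemeasurable (fc i).aestronglyMeasurable]
    rw [e1]
    have p0 : 0 ≤ ∫ x, f i x ∂(α : Measure Z) := integral_nonneg (f0 i)
    rcases p0.eq_or_lt with h | h
    · rw [← h]
      exact Filter.Eventually.of_forall fun p => by
        simpa using integral_nonneg (f0 i)
    · have hcont : Continuous fun p : ProbabilityMeasure Z × ProbabilityMeasure Z =>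
          ∫ x, f i x ∂(p.1 : Measure Z) :=
        (ProbabilityMeasure.continuous_integral_continuousMap
          (⟨f i, fc i⟩ : C(Z, ℝ))).comp continuous_fst
      filter_upwards [hcont.continuousAt.eventually_const_lt
        (show (1 - η) * ∫ x, f i x ∂(α : Measure Z) < ∫ x, f i x ∂(α : Measure Z) by nlinarith)]
        with p hp using hp.le
  have eb : ∀ i, ∀ᶠ p : ProbabilityMeasure Z × ProbabilityMeasure Z in nhds (α, β),
      (1 - η) * ∫ p, f i p.2 ∂π ≤ ∫ x, f i x ∂(p.2 : Measure Z) := by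
    intro i
    have e1 : ∫ p, f i p.2 ∂π = ∫ x, f i x ∂(β : Measure Z) := by
      rw [← h2, integral_map measurable_snd.aemeasurable (fc i).aestronglyMeasurable]
    rw [e1]
    have p0 : 0 ≤ ∫ x, f i x ∂(β : Measure Z) := integral_nonneg (f0 i)
    rcases p0.eq_or_lt with h | h
    · rw [← h]
      exact Filter.Eventually.of_forall fun p => by
        simpa using integral_nonneg (f0 i)
    · have hcont : Continuous fun p : ProbabilityMeasure Z × ProbabilityMeasure Z =>
          ∫ x, f i x ∂(p.2 : Measure Z) :=
        (ProbabilityMeasure.continuous_integral_continuousMap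
          (⟨f i, fc i⟩ : C(Z, ℝ))).comp continuous_snd
      filter_upwards [hcont.continuousAt.eventually_const_lt
        (show (1 - η) * ∫ x, f i x ∂(β : Measure Z) < ∫ x, f i x ∂(β : Measure Z) by nlinarith)]
        with p hp using hp.le
  filter_upwards [Filter.eventually_all.2 ea, Filter.eventually_all.2 eb] with p hpa hpb
  obtain ⟨π', g1, g2, g3⟩ := otc_main c hc C e hC f (fun i => (i : Z)) fc f0 f1
    (by
      intro i j x y hx hy
      have : dist (x, y) ((i : Z), (j : Z)) < δ := by
        rw [Prod.dist_eq]; exact max_lt (fd i x hx) (fd j y hy)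
      exact (hδ this).le)
    π (p.1 : Measure Z) (p.2 : Measure Z) (1 - η) (by linarith) (by linarith) hpa hpb
  have : transportCost c (p.1 : Measure Z) (p.2 : Measure Z) ≤ ∫ p, c p ∂π' :=
    csInf_le (otc_bddBelow c hc _ _) ⟨π', g1, g2, rfl⟩
  have h8 : r = ∫ p, c p ∂π + 8 * e := by simp only [he]; ring
  rw [h8]
  nlinarith

lemma otc_lsc (c : Z × Z → ℝ) (hc : Continuous c) :
    LowerSemicontinuous (fun p : ProbabilityMeasure Z × ProbabilityMeasure Z =>
      transportCost c (p.1 : Measure Z) (p.2 : Measure Z)) := by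
  rw [lowerSemicontinuous_iff_isClosed_preimage]
  intro r
  let M : ProbabilityMeasure (Z × Z) → ProbabilityMeasure Z × ProbabilityMeasure Z :=
    fun π => (π.map continuous_fst.measurable.aemeasurable,
      π.map continuous_snd.measurable.aemeasurable)
  have hM : Continuous M := (ProbabilityMeasure.continuous_map continuous_fst).prodMk
    (ProbabilityMeasure.continuous_map continuous_snd)
  have hI : Continuous fun π : ProbabilityMeasure (Z × Z) => ∫ p, c p ∂(π : Measure (Z × Z)) :=
    ProbabilityMeasure.continuous_integral_continuousMap (⟨c, hc⟩ : C(Z × Z, ℝ))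
  have hcl : IsClosed (M '' {π | ∫ p, c p ∂(π : Measure (Z × Z)) ≤ r}) :=
    ((isClosed_le hI continuous_const).isCompact.image hM).isClosed
  convert hcl
  ext ⟨α, β⟩
  simp only [Set.mem_preimage, Set.mem_Iic, Set.mem_image, Set.mem_ofPred_eq]
  constructor
  · intro h
    have hK : IsCompact (M ⁻¹' {(α, β)}) := (isClosed_singleton.preimage hM).isCompact
    have mem : ∀ π : Measure (Z × Z), π.map Prod.fst = α → π.map Prod.snd = β →
        ∃ π' : ProbabilityMeasure (Z × Z), (π' : Measure (Z × Z)) = π ∧ M π' = (α, β) := by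
      intro π h1 h2
      refine ⟨⟨π, otc_prob h1⟩, rfl, ?_⟩
      refine Prod.ext (Subtype.ext ?_) (Subtype.ext ?_)
      · exact h1
      · exact h2
    obtain ⟨π₁, -, hπ₁⟩ := mem ((α : Measure Z).prod β) (by simp) (by simp)
    obtain ⟨π₀, hπ₀, hmin⟩ := hK.exists_isMinOn ⟨π₁, hπ₁⟩ hI.continuousOn
    refine ⟨π₀, ?_, hπ₀⟩
    refine le_trans ?_ h
    refine le_csInf (otc_nonempty c _ _) ?_
    rintro v ⟨π, h1, h2, rfl⟩
    obtain ⟨π', rfl, h'⟩ := mem π h1 h2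
    exact hmin h'
  · rintro ⟨π, hπ, h⟩
    refine le_trans (csInf_le (otc_bddBelow c hc _ _) ⟨(π : Measure (Z × Z)), ?_, ?_, rfl⟩) hπ
    · exact congrArg (fun q => ((Prod.fst q : ProbabilityMeasure Z) : Measure Z)) h
    · exact congrArg (fun q => ((Prod.snd q : ProbabilityMeasure Z) : Measure Z)) h

lemma otc_push {X Θ : Type*}
    [MetricSpace X] [CompactSpace X] [MeasurableSpace X] [BorelSpace X]
    [MetricSpace Θ] [CompactSpace Θ]
    (T : Θ → X → Z) (hT : Continuous fun p : Θ × X => T p.1 p.2)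
    (hT' : ∀ θ, Continuous (T θ)) :
    Continuous fun p : ProbabilityMeasure X × Θ =>
      p.1.map (hT' p.2).measurable.aemeasurable := by
  borelize Θ
  have h : Continuous fun p : ProbabilityMeasure X × Θ =>
      ((diracProba p.2).prod p.1).map hT.measurable.aemeasurable :=
    (ProbabilityMeasure.continuous_map hT).comp (ProbabilityMeasure.continuous_prod.comp
      ((continuous_diracProba.comp continuous_snd).prodMk continuous_fst))
  convert h using 2 with p
  apply Subtype.ext
  change (p.1 : Measure X).map (T p.2) = Measure.map (fun q : Θ × X => T q.1 q.2)
    ((Measure.dirac p.2).prod (p.1 : Measure X))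
  rw [Measure.dirac_prod, Measure.map_map hT.measurable (by fun_prop)]
  rfl

end helpers

/-- Joint continuity of the transport cost: `(μ, θ, ν) ↦ W_c((T_θ)_#μ, ν)` is continuous
on `P(X) × Θ × P(Z)`, where the spaces of Borel probability measures carry the
topology of weak convergence. -/
theorem transportCost_jointly_continuous
    {X Z Θ : Type*}
    [MetricSpace X] [CompactSpace X] [MeasurableSpace X] [BorelSpace X]
    [MetricSpace Z] [CompactSpace Z] [MeasurableSpace Z] [BorelSpace Z]
    [MetricSpace Θ] [CompactSpace Θ]
    (T : Θ → X → Z) (hT : Continuous fun p : Θ × X => T p.1 p.2)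
    (c : Z × Z → ℝ) (hc : Continuous c) :
    Continuous (fun p : ProbabilityMeasure X × Θ × ProbabilityMeasure Z =>
      transportCost c ((p.1 : Measure X).map (T p.2.1)) (p.2.2 : Measure Z)) := by
  have hT' : ∀ θ, Continuous (T θ) := fun θ => by
    exact hT.comp (by fun_prop : Continuous fun x : X => (θ, x))
  have hW : Continuous (fun p : ProbabilityMeasure Z × ProbabilityMeasure Z =>
      transportCost c (p.1 : Measure Z) (p.2 : Measure Z)) :=
    continuous_iff_lower_upperSemicontinuous.2 ⟨otc_lsc c hc, otc_usc c hc⟩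
  have hp := otc_push T hT hT'
  exact hW.comp ((hp.comp (continuous_fst.prodMk (continuous_fst.comp continuous_snd))).prodMk
    (continuous_snd.comp continuous_snd))
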